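/- Let c₁, c₂, c₃, c₄ > 0, let m ≥ n ≥ 1 be integers, let ν be a positive measure in SMZ(m) with constants (c₁,c₂,c₃,c₄), and let q_0,…,q_{n−1} be functions with q_j ∈ Π_{j+1} that are orthonormal in L²(ν). Then for every x ∈ ℝ, ∫ |K̂_n(ν;x,y)|² dν(y) = Σ_{j=0}^{n−1} |𝔉(q_j)(x)|², and there exist constants a₁, a₂, a₃ > 0, depending only on (c₁,c₂,c₃,c₄), such that a₁ Σ_{j=0}^{n−1} ψ_j(x)² ≤ Σ_{j=0}^{n−1} |𝔉(q_j)(x)|² ≤ a₂ Σ_{j=0}^{n−1} ψ_j(x)² ≤ a₃ n^{1/2} for every x ∈ ℝ. -/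

import Mathlib

open MeasureTheory Filter ENNReal ProbabilityTheory

noncomputable def psiH (k : ℕ) (x : ℝ) : ℝ :=
  (Real.sqrt Real.pi * 2 ^ k * (Nat.factorial k : ℝ)) ^ (-(1 : ℝ) / 2) * (-1 : ℝ) ^ k *
    Real.exp (x ^ 2 / 2) * iteratedDeriv k (fun t : ℝ => Real.exp (-t ^ 2)) x

noncomputable def PiH (n : ℕ) : Submodule ℝ (ℝ → ℝ) :=
  Submodule.span ℝ {f : ℝ → ℝ | ∃ k, k < n ∧ f = psiH k}

noncomputable def degApproxH (p : ℝ≥0∞) (n : ℕ) (f : ℝ → ℝ) : ℝ≥0∞ :=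
  ⨅ (P : ℝ → ℝ) (_ : P ∈ PiH n), eLpNorm (fun x => f x - P x) p volume

noncomputable def fourierT (f : ℝ → ℝ) (ω : ℝ) : ℂ :=
  (Real.sqrt (2 * Real.pi) : ℂ)⁻¹ * ∫ t : ℝ, (f t : ℂ) * Complex.exp (-(Complex.I * ω * t))

def SMZ (m : ℕ) (c₁ c₂ c₃ c₄ : ℝ) (ν : Measure ℝ) : Prop :=
  (∀ P ∈ PiH m,
      ENNReal.ofReal c₁ * (∫⁻ t : ℝ, ENNReal.ofReal (P t ^ 2)) ≤ (∫⁻ t, ENNReal.ofReal (P t ^ 2) ∂ν) ∧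
      (∫⁻ t, ENNReal.ofReal (P t ^ 2) ∂ν) ≤ ENNReal.ofReal c₂ * (∫⁻ t : ℝ, ENNReal.ofReal (P t ^ 2))) ∧
  ENNReal.ofReal (c₃ * Real.sqrt m) ≤ ν Set.univ ∧ ν Set.univ ≤ ENNReal.ofReal (c₄ * Real.sqrt m)

open Polynomial in
noncomputable def Hp : ℕ → Polynomial ℝ
  | 0 => 1
  | (k+1) => 2 * X * Hp k - derivative (Hp k)

noncomputable def hh (k : ℕ) (x : ℝ) : ℝ := (Hp k).eval x * Real.exp (-x ^ 2 / 2)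

noncomputable def Nk (k : ℕ) : ℝ := Real.sqrt Real.pi * 2 ^ k * (Nat.factorial k : ℝ)

lemma Nk_pos (k : ℕ) : 0 < Nk k := by unfold Nk; positivity

lemma Nk_succ (k : ℕ) : Nk (k+1) = 2 * (k+1) * Nk k := by
  unfold Nk; rw [Nat.factorial_succ]; push_cast; ring

open Polynomial in
lemma Hp_deriv (k : ℕ) : derivative (Hp (k+1)) = 2 * ((k:ℝ[X]) + 1) * Hp k := by
  induction k with
  | zero => simp [Hp]
  | succ k ih =>
    have e : Hp (k+1+1) = 2 * X * Hp (k+1) - derivative (Hp (k+1)) := rfl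
    rw [e, ih]
    have e2 : Hp (k+1) = 2 * X * Hp k - derivative (Hp k) := rfl
    simp only [derivative_sub, derivative_mul, ih, derivative_X, derivative_add, derivative_natCast,
      derivative_one, derivative_ofNat]
    rw [show derivative (Hp k) = 2 * X * Hp k - Hp (k+1) by rw [e2]; ring]
    push_cast
    ring

lemma iter_eq (k : ℕ) : iteratedDeriv k (fun t : ℝ => Real.exp (-t ^ 2)) =
    fun x => (-1) ^ k * ((Hp k).eval x * Real.exp (-x ^ 2)) := by
  induction k with
  | zero => ext x; simp [Hp]
  | succ k ih =>
    rw [iteratedDeriv_succ, ih]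
    ext x
    have h1 : HasDerivAt (fun x : ℝ => Real.exp (-x ^ 2)) (Real.exp (-x ^ 2) * (-(2 * x))) x := by
      have := ((hasDerivAt_pow 2 x).neg).exp
      simpa using this
    have := (((Hp k).hasDerivAt x).mul h1).const_mul ((-1:ℝ) ^ k)
    have h2 := this.deriv
    refine Eq.trans h2 ?_
    simp only [Hp, Polynomial.eval_sub, Polynomial.eval_mul, Polynomial.eval_X, Polynomial.eval_ofNat]
    ring

lemma psiH_eq (k : ℕ) (x : ℝ) : psiH k x = (Nk k) ^ (-(1 : ℝ) / 2) * hh k x := by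
  unfold psiH hh Nk
  rw [iter_eq]
  have : Real.exp (-x ^ 2 / 2) = Real.exp (x ^ 2 / 2) * Real.exp (-x ^ 2) := by
    rw [← Real.exp_add]; congr 1; ring
  rw [this]
  have h : ((-1:ℝ)^k) * (-1)^k = 1 := by rw [← mul_pow]; simp
  simp only
  linear_combination ((√Real.pi * 2 ^ k * (k.factorial:ℝ)) ^ (-(1:ℝ) / 2) * Real.exp (x ^ 2 / 2) * ((Hp k).eval x * Real.exp (-x ^ 2))) * h

lemma rp_sq (k : ℕ) : (Nk k) ^ (-(1 : ℝ) / 2) * (Nk k) ^ (-(1 : ℝ) / 2) = (Nk k)⁻¹ := by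
  rw [← Real.rpow_add (Nk_pos k), ← Real.rpow_neg_one]; norm_num

lemma psiH_sq (k : ℕ) (x : ℝ) : psiH k x ^ 2 = hh k x ^ 2 / Nk k := by
  rw [psiH_eq, div_eq_mul_inv (hh k x ^ 2), ← rp_sq]; ring

lemma hh_cont (k : ℕ) : Continuous (hh k) := by
  unfold hh; fun_prop

lemma hh_hasDeriv (k : ℕ) (x : ℝ) : HasDerivAt (hh k) (x * hh k x - hh (k+1) x) x := by
  have h1 : HasDerivAt (fun x : ℝ => Real.exp (-x ^ 2 / 2)) (Real.exp (-x ^ 2 / 2) * (-x)) x := by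
    have := (((hasDerivAt_pow 2 x).neg).div_const 2).exp
    convert! this using 2
    simp
    ring
  have := ((Hp k).hasDerivAt x).mul h1
  refine this.congr_deriv ?_
  simp only [hh, Hp, Polynomial.eval_sub, Polynomial.eval_mul, Polynomial.eval_X, Polynomial.eval_ofNat]
  ring

lemma hh_rec (k : ℕ) (x : ℝ) : hh (k+2) x = 2 * x * hh (k+1) x - 2 * (k+1) * hh k x := by
  have : Hp (k+2) = 2 * Polynomial.X * Hp (k+1) - Polynomial.derivative (Hp (k+1)) := rfl
  simp only [hh, this, Hp_deriv]
  simp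
  ring

lemma hh_one (x : ℝ) : hh 1 x = 2 * x * hh 0 x := by
  simp [hh, Hp]

lemma poly_gauss_int (p : Polynomial ℝ) {b : ℝ} (hb : 0 < b) :
    Integrable (fun x : ℝ => p.eval x * Real.exp (-b * x ^ 2)) := by
  induction p using Polynomial.induction_on' with
  | add p q hp hq =>
    refine (hp.add hq).congr (ae_of_all _ fun x => ?_)
    simp [add_mul]
  | monomial n a =>
    have := (integrable_rpow_mul_exp_neg_mul_sq hb (s := n) (by
      have : (0:ℝ) ≤ n := Nat.cast_nonneg n
      linarith)).const_mul a
    refine this.congr (ae_of_all _ fun x => ?_)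
    simp [mul_assoc]

lemma hh_mul_int (p : Polynomial ℝ) (j k : ℕ) :
    Integrable (fun x : ℝ => p.eval x * (hh j x * hh k x)) := by
  refine (poly_gauss_int (p * Hp j * Hp k) one_pos).congr (ae_of_all _ fun x => ?_)
  have : Real.exp (-1 * x ^ 2) = Real.exp (-x ^ 2 / 2) * Real.exp (-x ^ 2 / 2) := by
    rw [← Real.exp_add]; congr 1; ring
  simp only [hh, this, Polynomial.eval_mul]
  ring

lemma hh_int (p : Polynomial ℝ) (k : ℕ) :
    Integrable (fun x : ℝ => p.eval x * hh k x) := by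
  refine (poly_gauss_int (p * Hp k) (b := 1/2) (by norm_num)).congr (ae_of_all _ fun x => ?_)
  have : Real.exp (-(1/2) * x ^ 2) = Real.exp (-x ^ 2 / 2) := by
    congr 1; ring
  simp only [hh, this, Polynomial.eval_mul]
  ring

lemma hh_mul_int0 (j k : ℕ) : Integrable (fun x : ℝ => hh j x * hh k x) := by
  simpa using hh_mul_int 1 j k

lemma hh_mul_intX (j k : ℕ) : Integrable (fun x : ℝ => x * (hh j x * hh k x)) := by
  simpa using hh_mul_int Polynomial.X j k

lemma ip_zero (k : ℕ) : ∫ x, hh (k+1) x * hh 0 x = 0 := by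
  have h : ∫ x, -(hh (k+1) x * hh 0 x) = 0 := by
    refine integral_eq_zero_of_hasDerivAt_of_integrable (f := fun x => hh k x * hh 0 x) ?_ ?_ ?_
    · intro x
      refine ((hh_hasDeriv k x).mul (hh_hasDeriv 0 x)).congr_deriv ?_
      have := hh_one x
      simp only [zero_add] at *
      rw [this]; ring
    · exact (hh_mul_int0 _ _).neg
    · exact hh_mul_int0 _ _
  rw [integral_neg] at h
  linarith

lemma ip_succ (j k : ℕ) : ∫ x, hh (k+1) x * hh (j+1) x = 2 * (j+1) * ∫ x, hh k x * hh j x := by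
  have h : ∫ x, ((2 * ((j:ℝ)+1)) * (hh k x * hh j x) - hh (k+1) x * hh (j+1) x) = 0 := by
    refine integral_eq_zero_of_hasDerivAt_of_integrable (f := fun x => hh k x * hh (j+1) x) ?_ ?_ ?_
    · intro x
      refine ((hh_hasDeriv k x).mul (hh_hasDeriv (j+1) x)).congr_deriv ?_
      rw [show j+1+1 = j+2 from rfl, hh_rec]; ring
    · exact ((hh_mul_int0 _ _).const_mul _).sub (hh_mul_int0 _ _)
    · exact hh_mul_int0 _ _
  rw [integral_sub ((hh_mul_int0 _ _).const_mul _) (hh_mul_int0 _ _), integral_const_mul] at h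
  linarith

lemma ip_eq (k j : ℕ) : ∫ x, hh k x * hh j x = if k = j then Nk k else 0 := by
  induction k generalizing j with
  | zero =>
    cases j with
    | zero =>
      have := integral_gaussian 1
      simp only [if_true, Nk]
      simp only [div_one] at this
      rw [show √Real.pi * 2 ^ 0 * ((Nat.factorial 0 : ℕ):ℝ) = √Real.pi by simp, ← this]
      congr 1; ext x
      simp only [hh, Hp, Polynomial.eval_one, one_mul]
      rw [← Real.exp_add]; congr 1; ring
    | succ j =>
      have := ip_zero j
      simp_rw [mul_comm (hh 0 _)]
      simpa using this
  | succ k ih =>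
    cases j with
    | zero => simpa using ip_zero k
    | succ j =>
      rw [ip_succ, ih]
      by_cases h : k = j
      · subst h; simp [Nk_succ]
      · simp [h]

lemma psi_int (j k : ℕ) : Integrable (fun x => psiH j x * psiH k x) := by
  refine ((hh_mul_int0 j k).const_mul ((Nk j) ^ (-(1 : ℝ) / 2) * (Nk k) ^ (-(1 : ℝ) / 2))).congr
    (ae_of_all _ fun x => ?_)
  simp only [psiH_eq]; ring

lemma psi_ortho (j k : ℕ) : ∫ x, psiH j x * psiH k x = if j = k then 1 else 0 := by
  have : ∀ x, psiH j x * psiH k x =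
      ((Nk j) ^ (-(1 : ℝ) / 2) * (Nk k) ^ (-(1 : ℝ) / 2)) * (hh j x * hh k x) := by
    intro x; simp only [psiH_eq]; ring
  simp_rw [this]
  rw [integral_const_mul, ip_eq]
  split_ifs with h
  · subst h; rw [rp_sq]; exact inv_mul_cancel₀ (Nk_pos j).ne'
  · simp

lemma psi_cont (k : ℕ) : Continuous (psiH k) := by
  have : psiH k = fun x => (Nk k) ^ (-(1 : ℝ) / 2) * hh k x := by ext x; exact psiH_eq k x
  rw [this]; exact continuous_const.mul (hh_cont k)

lemma S_deriv (n : ℕ) (x : ℝ) :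
    HasDerivAt (fun x => ∑ k ∈ Finset.range (n+1), hh k x ^ 2 / Nk k)
      (-(hh (n+1) x * hh n x) / Nk n) x := by
  induction n with
  | zero =>
    simp only [zero_add, Finset.sum_range_one]
    refine (((hh_hasDeriv 0 x).pow 2).div_const _).congr_deriv ?_
    simp only [zero_add, hh_one]
    congr 1
    push_cast
    ring
  | succ n ih =>
    simp_rw [Finset.sum_range_succ _ (n+1)]
    refine (ih.add (((hh_hasDeriv (n+1) x).pow 2).div_const _)).congr_deriv ?_
    rw [show n+1+1 = n+2 from rfl, hh_rec, Nk_succ]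
    have := (Nk_pos n).ne'
    have h2 : ((n:ℝ)+1) ≠ 0 := by positivity
    field_simp
    push_cast
    ring

lemma S_bound (n : ℕ) (x : ℝ) :
    ∑ k ∈ Finset.range (n+1), psiH k x ^ 2 ≤ Real.sqrt 2 * Real.sqrt (n+1 : ℕ) := by
  simp_rw [psiH_sq]
  rw [← Real.sqrt_mul (by norm_num)]
  set s := Real.sqrt (2 * (n+1 : ℕ)) with hs
  have hs0 : 0 < s := by rw [hs]; positivity
  have hs2 : s ^ 2 = 2 * (n+1) := by rw [hs, Real.sq_sqrt (by positivity)]; push_cast; ring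
  have hd := S_deriv n
  set S := fun x => ∑ k ∈ Finset.range (n+1), hh k x ^ 2 / Nk k with hS
  have hSi : Integrable S := by
    refine integrable_finsetSum _ fun k _ => ?_
    simpa [pow_two] using (hh_mul_int0 k k).div_const (Nk k)
  have hdi : Integrable (fun x => -(hh (n+1) x * hh n x) / Nk n) :=
    ((hh_mul_int0 _ _).neg).div_const _
  have hlim := tendsto_zero_of_hasDerivAt_of_integrableOn_Iic (a := x) (fun y _ => hd y)
    hdi.integrableOn hSi.integrableOn
  have hI := integral_Iic_of_hasDerivAt_of_tendsto (a := x) (hd x).continuousAt.continuousWithinAt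
    (fun y _ => hd y) hdi.integrableOn hlim
  rw [sub_zero] at hI
  change S x ≤ s
  rw [← hI]
  have hN := Nk_pos n
  set B := fun y => (1 / (2 * s * Nk n)) * (hh (n+1) y * hh (n+1) y) + (s / (2 * Nk n)) * (hh n y * hh n y) with hB
  have hBi : Integrable B := ((hh_mul_int0 _ _).const_mul _).add ((hh_mul_int0 _ _).const_mul _)
  have hB0 : ∀ y, 0 ≤ B y := fun y => by
    simp only [hB]
    have := mul_self_nonneg (hh (n+1) y)
    have := mul_self_nonneg (hh n y)
    positivity
  calc _ ≤ ∫ y in Set.Iic x, B y := by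
        refine setIntegral_mono hdi.integrableOn hBi.integrableOn fun y => ?_
        simp only [hB]
        have : (1 / (2 * s * Nk n)) * (hh (n+1) y * hh (n+1) y) + (s / (2 * Nk n)) * (hh n y * hh n y)
          - (-(hh (n+1) y * hh n y) / Nk n) = (hh (n+1) y + s * hh n y)^2 / (2 * s * Nk n) := by
          field_simp; ring
        have h0 : 0 ≤ (hh (n+1) y + s * hh n y)^2 / (2 * s * Nk n) := by positivity
        linarith
    _ ≤ ∫ y, B y := setIntegral_le_integral hBi (ae_of_all _ hB0)
    _ = s := by
        simp only [hB]
        rw [integral_add ((hh_mul_int0 _ _).const_mul _) ((hh_mul_int0 _ _).const_mul _),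
          integral_const_mul, integral_const_mul, ip_eq, ip_eq, if_pos rfl, if_pos rfl, Nk_succ,
          ← hs2]
        field_simp; ring

lemma e_norm (ω t : ℝ) : ‖Complex.exp (-(Complex.I * ω * t))‖ = 1 := by
  rw [Complex.norm_exp]; simp

lemma fint (p : Polynomial ℝ) (k : ℕ) (ω : ℝ) :
    Integrable (fun t : ℝ => ((p.eval t * hh k t : ℝ) : ℂ) * Complex.exp (-(Complex.I * ω * t))) := by
  have h := (hh_int p k)
  refine Integrable.mono' h.norm ?_ (ae_of_all _ fun t => ?_)
  · have := hh_cont k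
    apply Continuous.aestronglyMeasurable
    fun_prop
  · rw [norm_mul, e_norm, mul_one, Complex.norm_real]

lemma fint0 (k : ℕ) (ω : ℝ) :
    Integrable (fun t : ℝ => (hh k t : ℂ) * Complex.exp (-(Complex.I * ω * t))) := by
  simpa using fint 1 k ω

lemma fintX (k : ℕ) (ω : ℝ) :
    Integrable (fun t : ℝ => (t : ℂ) * (hh k t : ℂ) * Complex.exp (-(Complex.I * ω * t))) := by
  simpa using fint Polynomial.X k ω

lemma e_deriv (a : ℂ) (t : ℝ) : HasDerivAt (fun t : ℝ => Complex.exp (-(a * t)))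
    (-a * Complex.exp (-(a * t))) t := by
  have h1 : HasDerivAt (fun t : ℝ => -(a * (t:ℂ))) (-(a * 1)) t :=
    ((Complex.ofRealCLM.hasDerivAt (x := t)).const_mul a).neg
  refine h1.cexp.congr_deriv ?_
  ring

lemma F_hh (k : ℕ) (ω : ℝ) : ∫ t : ℝ, (hh k t : ℂ) * Complex.exp (-(Complex.I * ω * t)) =
    (Real.sqrt (2 * Real.pi) : ℂ) * (-Complex.I) ^ k * hh k ω := by
  induction k generalizing ω with
  | zero =>
    have := fourierIntegral_gaussian (b := 1/2) (by norm_num) (-(ω:ℂ))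
    have e : ∀ t : ℝ, (hh 0 t : ℂ) * Complex.exp (-(Complex.I * ω * t)) =
      Complex.exp (Complex.I * (-(ω:ℂ)) * t) * Complex.exp (-(1/2) * (t:ℂ) ^ 2) := by
      intro t
      simp only [hh, Hp, Polynomial.eval_one, one_mul]
      push_cast
      rw [mul_comm]
      congr 2 <;> ring
    simp_rw [e]
    rw [this]
    have h2 : ((Real.pi:ℂ) / (1/2)) ^ (1/2 : ℂ) = (Real.sqrt (2 * Real.pi) : ℂ) := by
      rw [Real.sqrt_eq_rpow, Complex.ofReal_cpow (by positivity)]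
      push_cast
      congr 1
      ring
    rw [h2]
    simp only [hh, Hp, Polynomial.eval_one, one_mul, pow_zero, mul_one]
    push_cast
    congr 2
    ring
  | succ k ih =>
    have hD : HasDerivAt (fun ω : ℝ => ∫ t : ℝ, (hh k t : ℂ) * Complex.exp (-(Complex.I * ω * t)))
        (∫ t : ℝ, (hh k t : ℂ) * (-(Complex.I * t) * Complex.exp (-(Complex.I * ω * t)))) ω := by
      refine (hasDerivAt_integral_of_dominated_loc_of_deriv_le (s := Set.univ)
        (F := fun (ω:ℝ) (t:ℝ) => (hh k t : ℂ) * Complex.exp (-(Complex.I * ω * t)))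
        (F' := fun (ω:ℝ) (t:ℝ) => (hh k t : ℂ) * (-(Complex.I * t) * Complex.exp (-(Complex.I * ω * t))))
        (bound := fun t => ‖t * hh k t‖)
        Filter.univ_mem ?_ (fint0 k ω) ?_ ?_ ?_ ?_).2
      · exact Filter.Eventually.of_forall fun w => (fint0 k w).aestronglyMeasurable
      · have := hh_cont k
        apply Continuous.aestronglyMeasurable
        fun_prop
      · refine ae_of_all _ fun t w _ => ?_
        rw [norm_mul, norm_mul, e_norm, Complex.norm_real, norm_neg, norm_mul, Complex.norm_I,
          Complex.norm_real, norm_mul]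
        apply le_of_eq; ring
      · have := hh_int Polynomial.X k
        simpa using this.norm
      · refine ae_of_all _ fun t w _ => ?_
        have := (e_deriv (Complex.I * t) w).const_mul (hh k t : ℂ)
        have e : ∀ w : ℝ, Complex.I * (w:ℂ) * t = Complex.I * t * w := fun w => by ring
        simp_rw [e]
        exact this
    have hE : HasDerivAt (fun ω : ℝ => ∫ t : ℝ, (hh k t : ℂ) * Complex.exp (-(Complex.I * ω * t)))
        ((Real.sqrt (2 * Real.pi) : ℂ) * (-Complex.I) ^ k * ((ω * hh k ω - hh (k+1) ω : ℝ) : ℂ)) ω := by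
      simp_rw [ih]
      exact ((hh_hasDeriv k ω).ofReal_comp).const_mul _
    have hu := hD.unique hE
    have hX : ∫ t : ℝ, (hh k t : ℂ) * (-(Complex.I * t) * Complex.exp (-(Complex.I * ω * t))) =
        -Complex.I * ∫ t : ℝ, (t : ℂ) * (hh k t : ℂ) * Complex.exp (-(Complex.I * ω * t)) := by
      rw [← integral_const_mul]
      congr 1; ext t; ring
    rw [hX] at hu
    have hP : ∫ t : ℝ, ((t : ℂ) * (hh k t : ℂ) * Complex.exp (-(Complex.I * ω * t))
        - (hh (k+1) t : ℂ) * Complex.exp (-(Complex.I * ω * t))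
        - (Complex.I * ω) * ((hh k t : ℂ) * Complex.exp (-(Complex.I * ω * t)))) = 0 := by
      refine integral_eq_zero_of_hasDerivAt_of_integrable
        (f := fun t : ℝ => (hh k t : ℂ) * Complex.exp (-(Complex.I * ω * t))) ?_ ?_ (fint0 k ω)
      · intro t
        refine (((hh_hasDeriv k t).ofReal_comp).mul (e_deriv (Complex.I * ω) t)).congr_deriv ?_
        push_cast
        ring
      · exact ((fintX k ω).sub (fint0 _ ω)).sub ((fint0 k ω).const_mul _)
    have hXi : Integrable (fun t : ℝ => (t : ℂ) * (hh k t : ℂ) * Complex.exp (-(Complex.I * ω * t))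
        - (hh (k+1) t : ℂ) * Complex.exp (-(Complex.I * ω * t))) := (fintX k ω).sub (fint0 _ ω)
    rw [integral_sub hXi ((fint0 k ω).const_mul _),
      integral_sub (fintX k ω) (fint0 _ ω), integral_const_mul, ih] at hP
    push_cast at hu
    have hI := Complex.I_sq
    rw [pow_succ]
    generalize (∫ t : ℝ, (t : ℂ) * (hh k t : ℂ) * Complex.exp (-(Complex.I * ω * t))) = Z at *
    generalize (∫ t : ℝ, (hh (k+1) t : ℂ) * Complex.exp (-(Complex.I * ω * t))) = W at *
    linear_combination -hP + Complex.I * hu + Z * hI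

lemma F_psi (k : ℕ) (ω : ℝ) : ∫ t : ℝ, (psiH k t : ℂ) * Complex.exp (-(Complex.I * ω * t)) =
    (Real.sqrt (2 * Real.pi) : ℂ) * (-Complex.I) ^ k * psiH k ω := by
  have : ∀ t : ℝ, (psiH k t : ℂ) * Complex.exp (-(Complex.I * ω * t)) =
    (((Nk k) ^ (-(1 : ℝ) / 2) : ℝ) : ℂ) * ((hh k t : ℂ) * Complex.exp (-(Complex.I * ω * t))) := by
    intro t; rw [psiH_eq]; push_cast; ring
  simp_rw [this]
  rw [integral_const_mul, F_hh, psiH_eq]; push_cast; ring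

lemma psi_fint (k : ℕ) (ω : ℝ) :
    Integrable (fun t : ℝ => (psiH k t : ℂ) * Complex.exp (-(Complex.I * ω * t))) := by
  refine ((fint0 k ω).const_mul (((Nk k) ^ (-(1 : ℝ) / 2) : ℝ) : ℂ)).congr (ae_of_all _ fun t => ?_)
  simp only [psiH_eq]; push_cast; ring

lemma F_sum {n : ℕ} (a : Fin n → ℝ) (ω : ℝ) :
    fourierT (∑ k, a k • psiH k) ω = ∑ k : Fin n, (a k : ℂ) * ((-Complex.I) ^ (k:ℕ) * psiH k ω) := by
  unfold fourierT
  have : ∀ t : ℝ, (((∑ k, a k • psiH k : ℝ → ℝ) t : ℝ) : ℂ) * Complex.exp (-(Complex.I * ω * t)) =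
    ∑ k, (a k : ℂ) * ((psiH k t : ℂ) * Complex.exp (-(Complex.I * ω * t))) := by
    intro t
    simp only [Finset.sum_apply, Pi.smul_apply, smul_eq_mul]
    push_cast
    rw [Finset.sum_mul]
    exact Finset.sum_congr rfl fun k _ => by ring
  simp_rw [this]
  rw [integral_finsetSum _ (fun (k : Fin n) _ => (psi_fint k ω).const_mul _), Finset.mul_sum]
  refine Finset.sum_congr rfl fun k _ => ?_
  rw [integral_const_mul, F_psi]
  have : (Real.sqrt (2 * Real.pi) : ℂ) ≠ 0 := by
    rw [Complex.ofReal_ne_zero]; positivity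
  field_simp

lemma mem_PiH {n : ℕ} {f : ℝ → ℝ} : f ∈ PiH n ↔ ∃ a : Fin n → ℝ, ∑ k, a k • psiH k = f := by
  rw [← Submodule.mem_span_range_iff_exists_fun, PiH]
  have : {f : ℝ → ℝ | ∃ k, k < n ∧ f = psiH k} = Set.range (fun k : Fin n => psiH k) := by
    ext g; constructor
    · rintro ⟨k, hk, rfl⟩; exact ⟨⟨k, hk⟩, rfl⟩
    · rintro ⟨k, rfl⟩; exact ⟨k, k.2, rfl⟩
  rw [this]

lemma PiH_mono {a b : ℕ} (h : a ≤ b) : PiH a ≤ PiH b := by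
  apply Submodule.span_mono
  rintro f ⟨k, hk, rfl⟩
  exact ⟨k, hk.trans_le h, rfl⟩

lemma PiH_cont {n : ℕ} {f : ℝ → ℝ} (hf : f ∈ PiH n) : Continuous f := by
  obtain ⟨a, rfl⟩ := mem_PiH.1 hf
  have : ∀ k : ℕ, Continuous (psiH k) := psi_cont
  rw [show (∑ k, a k • psiH k : ℝ → ℝ) = fun x => ∑ k, (a k • psiH k) x by ext x; simp]
  exact continuous_finsetSum _ fun (k : Fin n) _ => (this k).const_smul (a k)

lemma sum_sq_int {n : ℕ} (μ : Measure ℝ) (f : Fin n → ℝ → ℝ)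
    (hi : ∀ i j, Integrable (fun x => f i x * f j x) μ)
    (ho : ∀ i j, ∫ x, f i x * f j x ∂μ = if i = j then 1 else 0) (a : Fin n → ℝ) :
    ∫⁻ x, ENNReal.ofReal ((∑ k, a k • f k) x ^ 2) ∂μ = ENNReal.ofReal (∑ k, a k ^ 2) ∧
      ∫ x, (∑ k, a k * f k x) ^ 2 ∂μ = ∑ k, a k ^ 2 ∧
      Integrable (fun x => (∑ k, a k * f k x) ^ 2) μ := by
  have e : ∀ x, (∑ k, a k * f k x) ^ 2 = ∑ i, ∑ j, (a i * a j) * (f i x * f j x) := by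
    intro x
    rw [pow_two, Finset.sum_mul_sum]
    exact Finset.sum_congr rfl fun i _ => Finset.sum_congr rfl fun j _ => by ring
  have hI : Integrable (fun x => (∑ k, a k * f k x) ^ 2) μ := by
    simp_rw [e]
    exact integrable_finsetSum _ fun i _ => integrable_finsetSum _ fun j _ => (hi i j).const_mul _
  have h2 : ∫ x, (∑ k, a k * f k x) ^ 2 ∂μ = ∑ k, a k ^ 2 := by
    simp_rw [e]
    rw [integral_finsetSum _ fun i _ => integrable_finsetSum _ fun j _ => (hi i j).const_mul _]
    refine Finset.sum_congr rfl fun i _ => ?_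
    rw [integral_finsetSum _ fun j _ => (hi i j).const_mul _]
    simp_rw [integral_const_mul, ho]
    simp [pow_two]
  refine ⟨?_, h2, hI⟩
  rw [← h2, ofReal_integral_eq_lintegral_ofReal hI (ae_of_all _ fun x => sq_nonneg _)]
  simp

open Matrix in
lemma mat_bound {n : ℕ} (A : Matrix (Fin n) (Fin n) ℝ) (c₁ c₂ : ℝ) (h₁ : 0 < c₁) (h₂ : 0 < c₂)
    (h : ∀ w : Fin n → ℝ, c₁ * ∑ k, (w ᵥ* A) k ^ 2 ≤ ∑ k, w k ^ 2 ∧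
      ∑ k, w k ^ 2 ≤ c₂ * ∑ k, (w ᵥ* A) k ^ 2) (v : Fin n → ℝ) :
    c₂⁻¹ * ∑ k, v k ^ 2 ≤ ∑ k, (A *ᵥ v) k ^ 2 ∧ ∑ k, (A *ᵥ v) k ^ 2 ≤ c₁⁻¹ * ∑ k, v k ^ 2 := by
  have hp : ∀ u : Fin n → ℝ, 0 ≤ ∑ k, u k ^ 2 := fun u => Finset.sum_nonneg fun k _ => sq_nonneg _
  have cs : ∀ w : Fin n → ℝ, (w ⬝ᵥ (A *ᵥ v)) ^ 2 ≤ (∑ k, w k ^ 2) * ∑ k, (A *ᵥ v) k ^ 2 :=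
    fun w => Finset.sum_mul_sq_le_sq_mul_sq _ _ _
  have cs' : ∀ w : Fin n → ℝ, (w ⬝ᵥ (A *ᵥ v)) ^ 2 ≤ (∑ k, (w ᵥ* A) k ^ 2) * ∑ k, v k ^ 2 := by
    intro w
    rw [dotProduct_mulVec]
    exact Finset.sum_mul_sq_le_sq_mul_sq _ _ _
  have self : ∀ u : Fin n → ℝ, u ⬝ᵥ u = ∑ k, u k ^ 2 := fun u => by simp [dotProduct, pow_two]
  constructor
  · have inj : Function.Injective (A.vecMulLinear) := by
      rw [← LinearMap.ker_eq_bot, LinearMap.ker_eq_bot']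
      intro w hw
      have hw' : w ᵥ* A = 0 := hw
      have := (h w).2
      rw [hw'] at this
      simp only [Pi.zero_apply] at this
      have h0 : ∑ k, w k ^ 2 = 0 := le_antisymm (by simpa using this) (hp w)
      rw [Finset.sum_eq_zero_iff_of_nonneg (fun k _ => sq_nonneg _)] at h0
      ext k
      simpa using h0 k (Finset.mem_univ k)
    obtain ⟨u, hu⟩ := (LinearMap.injective_iff_surjective.1 inj) v
    have hu' : u ᵥ* A = v := hu
    have c := cs u
    rw [dotProduct_mulVec, hu', self] at c
    have hh := (h u).2
    rw [hu'] at hh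
    have := hp v
    have hA := hp (A *ᵥ v)
    rw [inv_mul_le_iff₀ h₂]
    rcases this.eq_or_lt with h0 | h0
    · rw [← h0]; positivity
    · have : (∑ k, v k ^ 2) * (∑ k, v k ^ 2) ≤ (∑ k, v k ^ 2) * (c₂ * ∑ k, (A *ᵥ v) k ^ 2) := by
        nlinarith [mul_le_mul_of_nonneg_right hh hA]
      exact le_of_mul_le_mul_left this h0
  · have c := cs' (A *ᵥ v)
    rw [self] at c
    have hh := (h (A *ᵥ v)).1
    have hv := hp v
    have hA := hp (A *ᵥ v)
    rw [le_inv_mul_iff₀ h₁]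
    rcases hA.eq_or_lt with h0 | h0
    · rw [← h0]; simpa using hv
    · have : (∑ k, (A *ᵥ v) k ^ 2) * (c₁ * ∑ k, (A *ᵥ v) k ^ 2) ≤ (∑ k, (A *ᵥ v) k ^ 2) * (∑ k, v k ^ 2) := by
        nlinarith [mul_le_mul_of_nonneg_right hh hv]
      exact le_of_mul_le_mul_left this h0

theorem stmt13 (c₁ c₂ c₃ c₄ : ℝ) (h₁ : 0 < c₁) (h₂ : 0 < c₂) (h₃ : 0 < c₃) (h₄ : 0 < c₄) :
    ∃ a₁ : ℝ, 0 < a₁ ∧ ∃ a₂ : ℝ, 0 < a₂ ∧ ∃ a₃ : ℝ, 0 < a₃ ∧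
      ∀ (m n : ℕ), 1 ≤ n → n ≤ m →
      ∀ (ν : Measure ℝ), SMZ m c₁ c₂ c₃ c₄ ν →
      ∀ (q : Fin n → ℝ → ℝ), (∀ j : Fin n, q j ∈ PiH (j + 1)) →
        (∀ i j : Fin n, (∫ x, q i x * q j x ∂ν) = if i = j then 1 else 0) →
      ∀ x : ℝ,
        (∫ y, ‖∑ j : Fin n, fourierT (q j) x * (q j y : ℂ)‖ ^ 2 ∂ν) =
            ∑ j : Fin n, ‖fourierT (q j) x‖ ^ 2 ∧
        a₁ * ∑ j ∈ Finset.range n, psiH j x ^ 2 ≤ ∑ j : Fin n, ‖fourierT (q j) x‖ ^ 2 ∧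
        ∑ j : Fin n, ‖fourierT (q j) x‖ ^ 2 ≤ a₂ * ∑ j ∈ Finset.range n, psiH j x ^ 2 ∧
        a₂ * ∑ j ∈ Finset.range n, psiH j x ^ 2 ≤ a₃ * Real.sqrt n := by
  refine ⟨c₂⁻¹, inv_pos.2 h₂, c₁⁻¹, inv_pos.2 h₁, c₁⁻¹ * Real.sqrt 2, by positivity, ?_⟩
  intro m n hn hnm ν hν q hq ho x
  have hqn : ∀ j, q j ∈ PiH n := fun j => PiH_mono (by have := j.2; omega) (hq j)
  have hcont : ∀ j, Continuous (q j) := fun j => PiH_cont (hqn j)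
  have hsq : ∀ j, Integrable (fun x => q j x ^ 2) ν := by
    intro j
    by_contra hcon
    have := ho j j
    simp only [if_true, ← pow_two] at this
    rw [integral_undef hcon] at this
    exact zero_ne_one this
  have hi : ∀ i j, Integrable (fun x => q i x * q j x) ν := by
    intro i j
    refine Integrable.mono' ((hsq i).add (hsq j)) ((hcont i).mul (hcont j)).aestronglyMeasurable
      (ae_of_all _ fun y => ?_)
    simp only [Pi.add_apply, Real.norm_eq_abs]
    rw [abs_le]
    constructor <;> nlinarith [sq_nonneg (q i y + q j y), sq_nonneg (q i y - q j y)]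
  have hA : ∀ j, ∃ a : Fin n → ℝ, ∑ k, a k • psiH k = q j := fun j => mem_PiH.1 (hqn j)
  choose A hA using hA
  have hcomb : ∀ w : Fin n → ℝ, ∑ j, w j • q j = ∑ k, (Matrix.vecMul w (Matrix.of A)) k • psiH k := by
    intro w
    simp_rw [← hA, Finset.smul_sum]
    rw [Finset.sum_comm]
    refine Finset.sum_congr rfl fun k _ => ?_
    simp only [Matrix.vecMul, dotProduct, Matrix.of_apply, Finset.sum_smul, smul_smul]
  have hpsi : ∀ i j : Fin n, ∫ x, psiH i x * psiH j x = if i = j then 1 else 0 := by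
    intro i j
    rw [psi_ortho]
    simp [Fin.ext_iff]
  have hmat : ∀ w : Fin n → ℝ, c₁ * ∑ k, (Matrix.vecMul w (Matrix.of A)) k ^ 2 ≤ ∑ k, w k ^ 2 ∧
      ∑ k, w k ^ 2 ≤ c₂ * ∑ k, (Matrix.vecMul w (Matrix.of A)) k ^ 2 := by
    intro w
    have hmem : ∑ j, w j • q j ∈ PiH m :=
      PiH_mono hnm (Submodule.sum_mem _ fun j _ => Submodule.smul_mem _ _ (hqn j))
    have hb := hν.1 _ hmem
    rw [(sum_sq_int ν q hi ho w).1, hcomb w,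
      (sum_sq_int volume (fun k : Fin n => psiH k) (fun i j => psi_int i j) hpsi _).1,
      ← ENNReal.ofReal_mul h₁.le, ← ENNReal.ofReal_mul h₂.le] at hb
    have h0 : ∀ u : Fin n → ℝ, 0 ≤ ∑ k, u k ^ 2 := fun u => Finset.sum_nonneg fun k _ => sq_nonneg _
    exact ⟨(ENNReal.ofReal_le_ofReal_iff (h0 _)).1 hb.1,
      (ENNReal.ofReal_le_ofReal_iff (mul_nonneg h₂.le (h0 _))).1 hb.2⟩
  have hbd := mat_bound (Matrix.of A) c₁ c₂ h₁ h₂ hmat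
  have hF : ∀ j, fourierT (q j) x =
      ∑ k : Fin n, (A j k : ℂ) * ((-Complex.I) ^ (k:ℕ) * psiH k x) := by
    intro j; rw [← hA j, F_sum]
  have hns : ∀ z : ℂ, ‖z‖ ^ 2 = z.re ^ 2 + z.im ^ 2 := by
    intro z; rw [Complex.sq_norm, Complex.normSq_apply]; ring
  set z : Fin n → ℂ := fun k => (-Complex.I) ^ (k:ℕ) * psiH k x with hz
  have hzn : ∀ k, (z k).re ^ 2 + (z k).im ^ 2 = psiH k x ^ 2 := by
    intro k
    rw [← hns, hz]
    simp
  have hre : ∀ j, (fourierT (q j) x).re = (Matrix.mulVec (Matrix.of A) (fun k => (z k).re)) j := by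
    intro j
    rw [hF, Complex.re_sum]
    simp only [Matrix.mulVec, dotProduct, Matrix.of_apply, Complex.re_ofReal_mul, hz]
  have him : ∀ j, (fourierT (q j) x).im = (Matrix.mulVec (Matrix.of A) (fun k => (z k).im)) j := by
    intro j
    rw [hF, Complex.im_sum]
    simp only [Matrix.mulVec, dotProduct, Matrix.of_apply, Complex.im_ofReal_mul, hz]
  have hS : ∑ j ∈ Finset.range n, psiH j x ^ 2 = ∑ k, (z k).re ^ 2 + ∑ k, (z k).im ^ 2 := by
    rw [Finset.sum_range, ← Finset.sum_add_distrib]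
    exact Finset.sum_congr rfl fun k _ => (hzn k).symm
  have hT : ∑ j : Fin n, ‖fourierT (q j) x‖ ^ 2 =
      ∑ j, (Matrix.mulVec (Matrix.of A) (fun k => (z k).re)) j ^ 2 +
      ∑ j, (Matrix.mulVec (Matrix.of A) (fun k => (z k).im)) j ^ 2 := by
    rw [← Finset.sum_add_distrib]
    refine Finset.sum_congr rfl fun j _ => ?_
    rw [hns, hre, him]
  have b1 := hbd (fun k => (z k).re)
  have b2 := hbd (fun k => (z k).im)
  refine ⟨?_, ?_, ?_, ?_⟩
  · have e : ∀ y, ‖∑ j : Fin n, fourierT (q j) x * (q j y : ℂ)‖ ^ 2 =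
        (∑ j, (fourierT (q j) x).re * q j y) ^ 2 + (∑ j, (fourierT (q j) x).im * q j y) ^ 2 := by
      intro y
      rw [hns, Complex.re_sum, Complex.im_sum]
      simp only [Complex.re_mul_ofReal, Complex.im_mul_ofReal]
    simp_rw [e]
    have r1 := sum_sq_int ν q hi ho (fun j => (fourierT (q j) x).re)
    have r2 := sum_sq_int ν q hi ho (fun j => (fourierT (q j) x).im)
    rw [integral_add r1.2.2 r2.2.2, r1.2.1, r2.2.1, ← Finset.sum_add_distrib]
    exact Finset.sum_congr rfl fun j _ => (hns _).symm
  · rw [hS, hT, mul_add]; exact add_le_add b1.1 b2.1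
  · rw [hS, hT, mul_add]; exact add_le_add b1.2 b2.2
  · obtain ⟨n', rfl⟩ : ∃ n', n = n' + 1 := ⟨n - 1, by omega⟩
    rw [mul_assoc]
    exact mul_le_mul_of_nonneg_left (S_bound n' x) (inv_pos.2 h₁).le
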